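/- Let μ ≥ 0 be a real number and n ≥ 1 an integer. Then the meromorphic continuation F_{2n, 2(μ+n)} of ζ_{2n, 2(μ+n)} has at z₀ := 2μ at most a simple pole, and lim_{z→2μ} (z−2μ)·F_{2n,2(μ+n)}(z) = −q^{μ}·(q^{−1}−q)^{2μ} / ((1−q^{2(n+μ)})·ln q). (This is the residue at z = 2μ of the zeta function tr(Aⁿ K^{2μ}|D|^{−z}) of the Podleś sphere spectral triple.) -/

import Mathlib

open Complex Real Filter Finset Topology

/-- The q-number `[x]_q = (q^x - q^{-x})/(q - q⁻¹)`. -/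
noncomputable def qnum (q x : ℝ) : ℝ := (q ^ x - q ^ (-x)) / (q - q⁻¹)

/-- For a positive real `a` and `w : ℂ`, `a^w := exp(w · ln a)`. -/
noncomputable def rcpow (a : ℝ) (w : ℂ) : ℂ := Complex.exp (w * (Real.log a : ℂ))

/-- The `(n,j)`-term of the q-zeta double series, corresponding to
`l = n + 1/2` and `k = j - n - 1/2`: `q^{βl+δk} · [l+1/2]_q^{-z}`. -/
noncomputable def qzetaTerm (q β δ : ℝ) (z : ℂ) (n j : ℕ) : ℂ :=
  ((q ^ (β * ((n : ℝ) + 1/2) + δ * ((j : ℝ) - (n : ℝ) - 1/2)) : ℝ) : ℂ) *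
    rcpow (qnum q ((n : ℝ) + 1)) (-z)

/-- The q-zeta function `ζ_{β,δ}(z)` as a double series. -/
noncomputable def qzeta (q β δ : ℝ) (z : ℂ) : ℂ :=
  ∑' n : ℕ, ∑ j ∈ Finset.range (2 * n + 2), qzetaTerm q β δ z n j

/-- The generalized binomial coefficient `C(z+j-1, j) = (1/j!)·∏_{i=0}^{j-1}(z+i)`. -/
noncomputable def binomC (z : ℂ) (j : ℕ) : ℂ :=
  (∏ i ∈ Finset.range j, (z + (i : ℂ))) / (Nat.factorial j : ℂ)

/-- The `j`-th term of the series defining `F_{β,δ}(z)`. -/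
noncomputable def Fterm (q β δ : ℝ) (z : ℂ) (j : ℕ) : ℂ :=
  binomC z j * (q : ℂ) ^ (2 * j) /
    ((1 - rcpow q (((β - δ + 2 * (j : ℝ)) : ℝ) + z)) *
     (1 - rcpow q (((β + δ + 2 * (j : ℝ)) : ℝ) + z)))

/-- The meromorphic continuation `F_{β,δ}`. -/
noncomputable def Ffun (q β δ : ℝ) (z : ℂ) : ℂ :=
  ((q ^ (β / 2) * (q ^ (-δ / 2) + q ^ (δ / 2)) : ℝ) : ℂ) * rcpow (1 - q ^ 2) z *
    ∑' j : ℕ, Fterm q β δ z j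

lemma norm_rcpow {a : ℝ} (ha : 0 < a) (w : ℂ) : ‖rcpow a w‖ = a ^ w.re := by
  rw [rcpow, Complex.norm_exp, Real.rpow_def_of_pos ha]
  simp [mul_comm]

lemma rcpow_ofReal {a : ℝ} (ha : 0 < a) (x : ℝ) : rcpow a (x : ℂ) = ((a ^ x : ℝ) : ℂ) := by
  rw [rcpow, Real.rpow_def_of_pos ha]
  push_cast
  rw [mul_comm]

lemma continuous_rcpow (a : ℝ) : Continuous (rcpow a) := by
  unfold rcpow
  fun_prop

/-- The real majorant of `‖binomC z j‖` for `‖z‖ ≤ M`, weighted by `q ^ (2 * j)`. -/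
noncomputable def binomMajorant (q M : ℝ) (j : ℕ) : ℝ :=
  (∏ i ∈ Finset.range j, (M + (i : ℝ))) / (Nat.factorial j : ℝ) * q ^ (2 * j)

lemma binomMajorant_pos {q M : ℝ} (hq0 : 0 < q) (hM : 0 < M) (j : ℕ) :
    0 < binomMajorant q M j := by
  have : 0 < ∏ i ∈ Finset.range j, (M + (i : ℝ)) := Finset.prod_pos fun i _ => by positivity
  unfold binomMajorant
  positivity

lemma summable_binomMajorant {q M : ℝ} (hq0 : 0 < q) (hq1 : q < 1) (hM : 0 < M) :
    Summable (binomMajorant q M) := by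
  have hq2 : q ^ 2 < 1 := by nlinarith
  refine summable_of_ratio_test_tendsto_lt_one hq2
    (Eventually.of_forall fun j => (binomMajorant_pos hq0 hM j).ne') ?_
  have hratio : ∀ j : ℕ, ‖binomMajorant q M (j + 1)‖ / ‖binomMajorant q M j‖
      = (1 + (M - 1) * (1 / ((j : ℝ) + 1))) * q ^ 2 := by
    intro j
    have hj := binomMajorant_pos hq0 hM j
    rw [Real.norm_of_nonneg (binomMajorant_pos hq0 hM _).le, Real.norm_of_nonneg hj.le,
      div_eq_iff hj.ne']
    unfold binomMajorant
    rw [Finset.prod_range_succ, Nat.factorial_succ]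
    push_cast
    field_simp
    ring
  simp only [hratio]
  have h := tendsto_one_div_add_atTop_nhds_zero_nat (𝕜 := ℝ)
  simpa using ((h.const_mul (M - 1)).const_add 1).mul_const (q ^ 2)

lemma one_sub_le_norm_one_sub_rcpow {q : ℝ} (hq0 : 0 < q) (hq1 : q < 1) {w : ℂ}
    (hw : 1 ≤ w.re) : 1 - q ≤ ‖1 - rcpow q w‖ := by
  have h1 : q ^ w.re ≤ q := by
    simpa using Real.rpow_le_rpow_of_exponent_ge hq0 hq1.le hw
  have h2 := norm_sub_norm_le (1 : ℂ) (rcpow q w)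
  rw [norm_one, norm_rcpow hq0] at h2
  linarith

lemma norm_Fterm_le {q β δ M : ℝ} (hq0 : 0 < q) (hq1 : q < 1) {z : ℂ} (hz : ‖z‖ ≤ M) {j : ℕ}
    (h₁ : 1 ≤ β - δ + 2 * (j : ℝ) + z.re) (h₂ : 1 ≤ β + δ + 2 * (j : ℝ) + z.re) :
    ‖Fterm q β δ z j‖ ≤ binomMajorant q M j / ((1 - q) * (1 - q)) := by
  have hd₁ := one_sub_le_norm_one_sub_rcpow hq0 hq1
    (w := ((β - δ + 2 * (j : ℝ) : ℝ) : ℂ) + z) (by simpa using h₁)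
  have hd₂ := one_sub_le_norm_one_sub_rcpow hq0 hq1
    (w := ((β + δ + 2 * (j : ℝ) : ℝ) : ℂ) + z) (by simpa using h₂)
  have hq : 0 < 1 - q := by linarith
  have hprod : ‖∏ i ∈ Finset.range j, (z + (i : ℂ))‖ ≤ ∏ i ∈ Finset.range j, (M + (i : ℝ)) := by
    rw [norm_prod]
    refine Finset.prod_le_prod (fun i _ => norm_nonneg _) fun i _ => ?_
    refine (norm_add_le _ _).trans ?_
    simpa using hz
  have hM : 0 ≤ ∏ i ∈ Finset.range j, (M + (i : ℝ)) := (norm_nonneg _).trans hprod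
  have hnum : ‖binomC z j * (q : ℂ) ^ (2 * j)‖ ≤ binomMajorant q M j := by
    rw [binomC, binomMajorant, norm_mul, norm_div, norm_pow, Complex.norm_natCast,
      Complex.norm_of_nonneg hq0.le]
    gcongr
  rw [Fterm, norm_div, norm_mul (1 - _)]
  exact div_le_div₀ ((norm_nonneg _).trans hnum) hnum (by positivity)
    (mul_le_mul hd₁ hd₂ hq.le (norm_nonneg _))

lemma tendsto_sub_div_one_sub_rcpow {q : ℝ} (hq : Real.log q ≠ 0) (c : ℂ) :
    Tendsto (fun z : ℂ => (z - c) / (1 - rcpow q (-c + z))) (𝓝[≠] c)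
      (𝓝 (-((Real.log q : ℂ))⁻¹)) := by
  have hL : (Real.log q : ℂ) ≠ 0 := by exact_mod_cast hq
  have hder : HasDerivAt (fun z : ℂ => rcpow q (-c + z)) (Real.log q : ℂ) c := by
    unfold rcpow
    have := (((hasDerivAt_id c).const_add (-c)).mul_const (Real.log q : ℂ)).cexp
    simpa using this
  have hs := ((hasDerivAt_iff_tendsto_slope.1 hder).inv₀ hL).neg
  refine hs.congr fun z => ?_
  have h0 : rcpow q (-c + c) = 1 := by simp [rcpow]
  rw [slope_def_field, h0, inv_div, ← neg_sub (1 : ℂ), div_neg, neg_neg]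

/-- Near a point `c` at which only the term `j = 0` may be singular, the series `∑ Fterm` has
the same residue as its zeroth term. -/
lemma tendsto_sub_mul_tsum_Fterm {q β δ : ℝ} (hq0 : 0 < q) (hq1 : q < 1) {c l : ℂ}
    (h₁ : 0 ≤ β - δ + c.re) (h₂ : 0 ≤ β + δ + c.re)
    (hl : Tendsto (fun z : ℂ => (z - c) * Fterm q β δ z 0) (𝓝[≠] c) (𝓝 l)) :
    Tendsto (fun z : ℂ => (z - c) * ∑' j : ℕ, Fterm q β δ z j) (𝓝[≠] c) (𝓝 l) := by
  set M : ℝ := ‖c‖ + 1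
  have hM : 0 < M := by positivity
  set u : ℕ → ℝ := fun j => binomMajorant q M (j + 1) / ((1 - q) * (1 - q))
  have hu : Summable u :=
    ((summable_nat_add_iff 1).2 (summable_binomMajorant hq0 hq1 hM)).div_const _
  have hball : ∀ᶠ z : ℂ in 𝓝[≠] c, ‖z - c‖ < 1 := by
    refine eventually_nhdsWithin_of_eventually_nhds ?_
    filter_upwards [Metric.ball_mem_nhds c one_pos] with z hz
    simpa [dist_eq_norm] using hz
  have hbound : ∀ᶠ z : ℂ in 𝓝[≠] c, ∀ j : ℕ, ‖Fterm q β δ z (j + 1)‖ ≤ u j := by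
    filter_upwards [hball] with z hz j
    have hre : -1 ≤ z.re - c.re := by
      have := (abs_le.1 ((Complex.abs_re_le_norm (z - c)).trans hz.le)).1
      simpa using this
    have hzM : ‖z‖ ≤ M := by
      have := norm_le_norm_add_norm_sub' z c
      simp only [M]
      linarith
    have hj : (0 : ℝ) ≤ j := j.cast_nonneg
    refine norm_Fterm_le hq0 hq1 hzM ?_ ?_ <;> push_cast <;> linarith
  have htail : Tendsto (fun z : ℂ => (z - c) * ∑' j : ℕ, Fterm q β δ z (j + 1))
      (𝓝[≠] c) (𝓝 0) := by
    have hlin : Tendsto (fun z : ℂ => z - c) (𝓝[≠] c) (𝓝 0) := by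
      refine Tendsto.mono_left ?_ nhdsWithin_le_nhds
      simpa using (tendsto_id (x := 𝓝 c)).sub_const c
    refine hlin.zero_mul_isBoundedUnder_le ⟨∑' j, u j, ?_⟩
    rw [eventually_map]
    filter_upwards [hbound] with z hz
    exact tsum_of_norm_bounded hu.hasSum hz
  have hsum := hl.add htail
  rw [add_zero] at hsum
  refine hsum.congr' ?_
  filter_upwards [hbound] with z hz
  have hs : Summable (Fterm q β δ z) :=
    (summable_nat_add_iff 1).1 (Summable.of_norm_bounded hu hz)
  rw [hs.tsum_eq_zero_add, mul_add]

theorem statement15 (q : ℝ) (hq0 : 0 < q) (hq1 : q < 1) (μ : ℝ) (hμ : 0 ≤ μ)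
    (n : ℕ) (hn : 1 ≤ n) :
    Tendsto (fun z : ℂ => (z - ((2 * μ : ℝ) : ℂ)) * Ffun q (2 * (n : ℝ)) (2 * (μ + (n : ℝ))) z)
      (𝓝[≠] ((2 * μ : ℝ) : ℂ))
      (𝓝 ((-(q ^ μ * (q⁻¹ - q) ^ (2 * μ)) /
        ((1 - q ^ (2 * ((n : ℝ) + μ))) * Real.log q) : ℝ) : ℂ)) := by
  set β : ℝ := 2 * (n : ℝ) with hβ
  set δ : ℝ := 2 * (μ + (n : ℝ)) with hδ
  have hn' : (1 : ℝ) ≤ n := by exact_mod_cast hn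
  have hlog : Real.log q < 0 := Real.log_neg hq0 hq1
  have hq2 : 0 < 1 - q ^ 2 := by nlinarith
  have hx1 : q ^ δ < 1 := Real.rpow_lt_one hq0.le hq1 (by simp only [hδ]; linarith)
  have hx0 : 0 < q ^ δ := Real.rpow_pos_of_pos hq0 _
  have hxx : q ^ (2 * δ) = q ^ δ * q ^ δ := by rw [← Real.rpow_add hq0, two_mul]
  have hden : (1 - q ^ (2 * δ)) ≠ 0 := by nlinarith
  have hsecond : Tendsto (fun z : ℂ => 1 - rcpow q (((β + δ + 2 * ((0 : ℕ) : ℝ) : ℝ) : ℂ) + z))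
      (𝓝[≠] ((2 * μ : ℝ) : ℂ)) (𝓝 ((1 - q ^ (2 * δ) : ℝ) : ℂ)) := by
    have hcont : Continuous
        (fun z : ℂ => 1 - rcpow q (((β + δ + 2 * ((0 : ℕ) : ℝ) : ℝ) : ℂ) + z)) :=
      continuous_const.sub ((continuous_rcpow q).comp (continuous_const.add continuous_id))
    have h := (hcont.tendsto ((2 * μ : ℝ) : ℂ)).mono_left
      (nhdsWithin_le_nhds (s := {((2 * μ : ℝ) : ℂ)}ᶜ))
    have he : β + δ + 2 * ((0 : ℕ) : ℝ) + 2 * μ = 2 * δ := by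
      simp only [hβ, hδ]; push_cast; ring
    rwa [← Complex.ofReal_add, he, rcpow_ofReal hq0, ← Complex.ofReal_one,
      ← Complex.ofReal_sub] at h
  have hzeroth : Tendsto (fun z : ℂ => (z - ((2 * μ : ℝ) : ℂ)) * Fterm q β δ z 0)
      (𝓝[≠] ((2 * μ : ℝ) : ℂ))
      (𝓝 (-((Real.log q : ℂ))⁻¹ / ((1 - q ^ (2 * δ) : ℝ) : ℂ))) := by
    refine ((tendsto_sub_div_one_sub_rcpow hlog.ne ((2 * μ : ℝ) : ℂ)).div hsecond
      (by exact_mod_cast hden)).congr fun z => ?_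
    have he : β - δ + 2 * ((0 : ℕ) : ℝ) = -(2 * μ) := by
      simp only [hβ, hδ]; push_cast; ring
    simp only [Pi.div_apply]
    rw [Fterm, he, Complex.ofReal_neg]
    simp [binomC, div_eq_mul_inv]
    ring
  have hseries := tendsto_sub_mul_tsum_Fterm hq0 hq1
    (by rw [Complex.ofReal_re]; simp only [hβ, hδ]; linarith)
    (by rw [Complex.ofReal_re]; simp only [hβ, hδ]; linarith) hzeroth
  have hpow := ((continuous_rcpow (1 - q ^ 2)).tendsto ((2 * μ : ℝ) : ℂ)).mono_left
      (nhdsWithin_le_nhds (s := {((2 * μ : ℝ) : ℂ)}ᶜ))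
  rw [rcpow_ofReal hq2] at hpow
  have hall := (hpow.const_mul
    ((q ^ (β / 2) * (q ^ (-δ / 2) + q ^ (δ / 2)) : ℝ) : ℂ)).mul hseries
  have hprefactor : q ^ (β / 2) * (q ^ (-δ / 2) + q ^ (δ / 2)) = q ^ (-μ) * (1 + q ^ δ) := by
    rw [mul_add, mul_add, mul_one, ← Real.rpow_add hq0, ← Real.rpow_add hq0,
      ← Real.rpow_add hq0]
    simp only [hβ, hδ]
    congr 2 <;> ring
  have hbase : (1 - q ^ 2) ^ (2 * μ) = q ^ (2 * μ) * (q⁻¹ - q) ^ (2 * μ) := by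
    rw [← Real.mul_rpow hq0.le (by linarith [(one_lt_inv₀ hq0).2 hq1])]
    congr 1
    field_simp
  have hmerge : q ^ μ = q ^ (-μ) * q ^ (2 * μ) := by
    rw [← Real.rpow_add hq0]
    congr 1
    ring
  have hvalue : -(q ^ μ * (q⁻¹ - q) ^ (2 * μ)) / ((1 - q ^ (2 * ((n : ℝ) + μ))) * Real.log q)
      = q ^ (β / 2) * (q ^ (-δ / 2) + q ^ (δ / 2)) * (1 - q ^ 2) ^ (2 * μ) *
        (-(Real.log q)⁻¹ / (1 - q ^ (2 * δ))) := by
    have h1 : (1 - q ^ δ) ≠ 0 := by linarith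
    have h2 : (1 + q ^ δ) ≠ 0 := by linarith
    have h3 : 1 - q ^ (2 * δ) = (1 - q ^ δ) * (1 + q ^ δ) := by rw [hxx]; ring
    rw [hprefactor, hbase, hmerge, add_comm (n : ℝ) μ, ← hδ, h3]
    have := hlog.ne
    field_simp
  rw [hvalue]
  push_cast at hall ⊢
  refine hall.congr fun z => ?_
  rw [Ffun]
  push_cast
  ring
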